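/- Let G be a countable amenable group and F a continuous bundle random dynamical system over a measure-preserving dynamical system (Ω,𝓕,ℙ,G) on a compact metric space (X,d). If F is mean-L-stable, then F is Banach-mean equicontinuous. -/

import Mathlib

open Filter MeasureTheory Topology Metric Set ENNReal
open scoped symmDiff Classical

/-- `Φ` is a (left) Følner sequence of nonempty finite subsets of `G`. -/
def IsFolner {G : Type*} [Group G] (Φ : ℕ → Finset G) : Prop :=
  (∀ n, (Φ n).Nonempty) ∧
    ∀ g : G,
      Tendsto (fun n => ((((Φ n).image fun t => g * t) ∆ Φ n).card : ℝ) / ((Φ n).card : ℝ))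
        atTop (𝓝 0)

/-- The upper Banach density `BD*(E)` of a subset `E` of an amenable group `G`. -/
noncomputable def upperBanachDensity {G : Type*} [Group G] (E : Set G) : ℝ≥0∞ :=
  ⨆ (Φ : ℕ → Finset G) (_ : IsFolner Φ),
    Filter.limsup
      (fun n => (((Φ n).filter fun g => g ∈ E).card : ℝ≥0∞) / ((Φ n).card : ℝ≥0∞)) atTop

/-- A continuous bundle random dynamical system over the measure-preserving dynamical
system given by the measure-preserving action of `G` on the probability space `(Ω, μ)`,
with fibers `E ω ⊆ X` and fiber maps `F g ω : E ω → E (g • ω)`. -/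
structure RDS (G : Type*) [Group G] (Ω : Type*) [MeasurableSpace Ω] [MulAction G Ω]
    (μ : Measure Ω) (X : Type*) [MetricSpace X] [MeasurableSpace X] [BorelSpace X] where
  E : Ω → Set X
  F : G → Ω → X → X
  measurePreserving_smul : ∀ g : G, MeasurePreserving (fun ω : Ω => g • ω) μ μ
  measurableSet_carrier : MeasurableSet {p : Ω × X | p.2 ∈ E p.1}
  mapsTo : ∀ (g : G) (ω : Ω), Set.MapsTo (F g ω) (E ω) (E (g • ω))
  one_apply : ∀ (ω : Ω), ∀ x ∈ E ω, F 1 ω x = x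
  measurable_F : ∀ g : G, Measurable fun p : {p : Ω × X // p.2 ∈ E p.1} => F g p.1.1 p.1.2
  cocycle : ∀ (g₁ g₂ : G) (ω : Ω), ∀ x ∈ E ω, F g₂ (g₁ • ω) (F g₁ ω x) = F (g₂ * g₁) ω x
  ae_fiber : ∀ᵐ ω ∂μ, (E ω).Nonempty ∧ IsCompact (E ω) ∧ ∀ g : G, ContinuousOn (F g ω) (E ω)

namespace RDS

variable {G : Type*} [Group G] {Ω : Type*} [MeasurableSpace Ω] [MulAction G Ω]
  {μ : Measure Ω} {X : Type*} [MetricSpace X] [MeasurableSpace X] [BorelSpace X]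
  (S : RDS G Ω μ X)

/-- The carrier `𝓔 ⊆ Ω × X` of the RDS. -/
def carrier : Set (Ω × X) := {p : Ω × X | p.2 ∈ S.E p.1}

/-- `d̃(tx, ty) := sup_ω d(F_{t,ω} x, F_{t,ω} y)` when `x, y` lie in a common fiber,
and `∞` otherwise. -/
noncomputable def dt (t : G) (x y : X) : ℝ≥0∞ :=
  if ∃ ω : Ω, x ∈ S.E ω ∧ y ∈ S.E ω then
    ⨆ ω ∈ {ω : Ω | x ∈ S.E ω ∧ y ∈ S.E ω}, edist (S.F t ω x) (S.F t ω y)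
  else ⊤

/-- `D^{(r)}_𝓕(x,y) := limsup_n (1/|Φ n|) Σ_{t ∈ Φ n} d̃(tx,ty)`. -/
noncomputable def DFol (Φ : ℕ → Finset G) (x y : X) : ℝ≥0∞ :=
  Filter.limsup (fun n => (∑ t ∈ Φ n, S.dt t x y) / ((Φ n).card : ℝ≥0∞)) atTop

/-- The Weyl pseudometric `D^{(r)}(x,y)`, the sup over all Følner sequences. -/
noncomputable def DW (x y : X) : ℝ≥0∞ :=
  ⨆ (Φ : ℕ → Finset G) (_ : IsFolner Φ), S.DFol Φ x y

/-- The Banach pseudometric `D̄^{(r)}(x,y) := inf_K sup_g (1/|K|) Σ_{t ∈ Kg} d̃(tx,ty)`. -/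
noncomputable def DB (x y : X) : ℝ≥0∞ :=
  ⨅ (K : Finset G) (_ : K.Nonempty),
    ⨆ g : G, (∑ t ∈ K.image fun k => k * g, S.dt t x y) / ((K.card : ℝ≥0∞))

/-- Weyl-mean equicontinuity of the RDS. -/
def WME : Prop :=
  ∀ ε : ℝ, 0 < ε → ∃ δ : ℝ, 0 < δ ∧ ∀ (ω : Ω) (x y : X),
    x ∈ S.E ω → y ∈ S.E ω → dist x y < δ → S.DW x y < ENNReal.ofReal ε

/-- Banach-mean equicontinuity of the RDS. -/
def BME : Prop :=
  ∀ ε : ℝ, 0 < ε → ∃ δ : ℝ, 0 < δ ∧ ∀ (ω : Ω) (x y : X),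
    x ∈ S.E ω → y ∈ S.E ω → dist x y < δ → S.DB x y < ENNReal.ofReal ε

/-- Mean-L-stability: points starting close stay `ε`-close outside a set of
upper Banach density less than `ε`. -/
def MeanLStable : Prop :=
  ∀ ε : ℝ, 0 < ε → ∃ δ : ℝ, 0 < δ ∧ ∀ (ω : Ω) (x y : X),
    x ∈ S.E ω → y ∈ S.E ω → dist x y < δ →
      upperBanachDensity {g : G | ENNReal.ofReal ε ≤ S.dt g x y} < ENNReal.ofReal ε

/-- `Ĥ^{(r)}_{𝓕,ω}(x,y)`. -/
noncomputable def HFol (Φ : ℕ → Finset G) (ω : Ω) (x y : X) : ℝ≥0∞ :=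
  if x ∈ S.E ω ∧ y ∈ S.E ω then
    Filter.limsup
      (fun n => (∑ t ∈ Φ n, edist (S.F t ω x) (S.F t ω y)) / ((Φ n).card : ℝ≥0∞)) atTop
  else ⊤

/-- `Ĥ^{(r)}_ω(x,y)`, the sup over all Følner sequences of `Ĥ^{(r)}_{𝓕,ω}(x,y)`. -/
noncomputable def HW (ω : Ω) (x y : X) : ℝ≥0∞ :=
  ⨆ (Φ : ℕ → Finset G) (_ : IsFolner Φ), S.HFol Φ ω x y

/-- `Ĥ^{(r)}(x,y) := sup_ω Ĥ^{(r)}_ω(x,y)`. -/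
noncomputable def Hsup (x y : X) : ℝ≥0∞ := ⨆ ω : Ω, S.HW ω x y

/-- Weyl-mean sensitivity of the RDS. -/
def WeylMeanSensitive : Prop :=
  ∃ δ : ℝ, 0 < δ ∧ ∀ (x : X) (ε : ℝ), 0 < ε →
    ∃ (ω : Ω) (y : X), y ∈ S.E ω ∩ Metric.ball x ε ∧ ENNReal.ofReal δ < S.HW ω x y

/-- The set `𝔼_{ω,ε}` of points of `E ω` around which the Weyl pseudometric is
uniformly `< ε` on a small relative ball. -/
def EE (ω : Ω) (ε : ℝ) : Set X :=
  {x ∈ S.E ω | ∃ δ : ℝ, 0 < δ ∧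
    ∀ y ∈ Metric.ball x δ ∩ S.E ω, ∀ z ∈ Metric.ball x δ ∩ S.E ω,
      S.DW y z < ENNReal.ofReal ε}

/-- The set `𝔼` of Weyl-mean equicontinuous points of the RDS. -/
def meanEqPts : Set X :=
  {x : X | ∀ ε : ℝ, 0 < ε → ∃ δ : ℝ, 0 < δ ∧ ∀ (ω : Ω) (y : X),
    y ∈ S.E ω → dist x y < δ → S.DW x y < ENNReal.ofReal ε}

end RDS

/-- `D_𝓕(x,y)` for a (deterministic) group action `T` of `G` on `K`. -/
noncomputable def actDFol {G K : Type*} [Group G] [PseudoMetricSpace K]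
    (T : G → K → K) (Φ : ℕ → Finset G) (x y : K) : ℝ≥0∞ :=
  Filter.limsup (fun n => (∑ t ∈ Φ n, edist (T t x) (T t y)) / ((Φ n).card : ℝ≥0∞)) atTop

/-- The Weyl pseudometric `D(x,y)` for a group action. -/
noncomputable def actDW {G K : Type*} [Group G] [PseudoMetricSpace K]
    (T : G → K → K) (x y : K) : ℝ≥0∞ :=
  ⨆ (Φ : ℕ → Finset G) (_ : IsFolner Φ), actDFol T Φ x y

/-- The Banach pseudometric `D̄(x,y)` for a group action. -/
noncomputable def actDB {G K : Type*} [Group G] [PseudoMetricSpace K]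
    (T : G → K → K) (x y : K) : ℝ≥0∞ :=
  ⨅ (F : Finset G) (_ : F.Nonempty),
    ⨆ g : G, (∑ t ∈ F.image fun k => k * g, edist (T t x) (T t y)) / ((F.card : ℝ≥0∞))

/-- The set of Weyl-mean equicontinuous points of a group action. -/
def actMeanEqPts {G K : Type*} [Group G] [PseudoMetricSpace K]
    (T : G → K → K) : Set K :=
  {x : K | ∀ ε : ℝ, 0 < ε → ∃ δ : ℝ, 0 < δ ∧
    ∀ y : K, dist x y < δ → actDW T x y < ENNReal.ofReal ε}

/-- Right translates of the members of a left Følner sequence form a left Følner sequence. -/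
theorem IsFolner.image_mul_right {G : Type*} [Group G] {Φ : ℕ → Finset G} (hΦ : IsFolner Φ)
    (γ : ℕ → G) : IsFolner fun n => (Φ n).image fun k => k * γ n := by
  refine ⟨fun n => (hΦ.1 n).image _, fun g => (hΦ.2 g).congr fun n => ?_⟩
  have hcomm : (((Φ n).image fun k => k * γ n).image fun t => g * t) =
      ((Φ n).image fun t => g * t).image fun k => k * γ n := by
    simp only [Finset.image_image, Function.comp_def, mul_assoc]
  have hinj : Function.Injective fun k : G => k * γ n := mul_left_injective _
  rw [hcomm, ← Finset.image_symmDiff _ _ hinj, Finset.card_image_of_injective _ hinj,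
    Finset.card_image_of_injective _ hinj]

/-- A set of upper Banach density less than `c` has relative density less than `c` in all right
translates of a single nonempty finite set. -/
theorem exists_forall_card_filter_div_lt_of_upperBanachDensity_lt {G : Type*} [Group G]
    (hG : ∃ Φ : ℕ → Finset G, IsFolner Φ) {A : Set G} {c : ℝ≥0∞}
    (hA : upperBanachDensity A < c) :
    ∃ K : Finset G, K.Nonempty ∧ ∀ g : G,
      ((((K.image fun k => k * g).filter fun t => t ∈ A).card : ℝ≥0∞) / (K.card : ℝ≥0∞)) < c := by
  obtain ⟨Φ, hΦ⟩ := hG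
  by_contra! h
  choose γ hγ using fun n => h (Φ n) (hΦ.1 n)
  refine hA.not_ge ?_
  refine le_trans ?_ (le_iSup₂_of_le _ (hΦ.image_mul_right γ) le_rfl)
  refine le_limsup_of_frequently_le (Frequently.of_forall fun n => ?_)
  rw [Finset.card_image_of_injective _ (mul_left_injective _)]
  exact hγ n

namespace RDS

variable {G : Type*} [Group G] {Ω : Type*} [MeasurableSpace Ω] [MulAction G Ω]
  {μ : Measure Ω} {X : Type*} [MetricSpace X] [MeasurableSpace X] [BorelSpace X]
  (S : RDS G Ω μ X)

theorem dt_le_diam [CompactSpace X] {ω : Ω} {x y : X} (hx : x ∈ S.E ω) (hy : y ∈ S.E ω) (t : G) :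
    S.dt t x y ≤ ENNReal.ofReal (Metric.diam (univ : Set X)) := by
  rw [dt, if_pos ⟨ω, hx, hy⟩]
  refine iSup₂_le fun ω' _ => ?_
  rw [edist_dist]
  exact ENNReal.ofReal_le_ofReal
    (Metric.dist_le_diam_of_mem isCompact_univ.isBounded (mem_univ _) (mem_univ _))

/-- An average of `d̃(tx, ty)` is controlled by a threshold `η`, a global bound `C`, and the
frequency of a set off which the threshold is not exceeded. -/
theorem sum_dt_div_card_le {x y : X} {C η : ℝ≥0∞} (hC : ∀ t : G, S.dt t x y ≤ C)
    {A : Set G} (hA : ∀ t ∉ A, S.dt t x y ≤ η) {K : Finset G} (hK : K.Nonempty) (g : G) :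
    (∑ t ∈ K.image fun k => k * g, S.dt t x y) / (K.card : ℝ≥0∞) ≤
      η + ((((K.image fun k => k * g).filter fun t => t ∈ A).card : ℝ≥0∞) /
        (K.card : ℝ≥0∞)) * C := by
  have hpt : ∀ t ∈ K.image fun k => k * g,
      S.dt t x y ≤ η + if t ∈ A then C else 0 := by
    intro t _
    split_ifs with ht
    · exact (hC t).trans le_add_self
    · simpa using hA t ht
  have hK0 : (K.card : ℝ≥0∞) ≠ 0 := by exact_mod_cast hK.card_pos.ne'
  calc (∑ t ∈ K.image fun k => k * g, S.dt t x y) / (K.card : ℝ≥0∞)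
      ≤ (∑ t ∈ K.image fun k => k * g, (η + if t ∈ A then C else 0)) /
          (K.card : ℝ≥0∞) := by
        gcongr with t ht
        exact hpt t ht
    _ = _ := by
        rw [Finset.sum_add_distrib, ← Finset.sum_filter, Finset.sum_const, Finset.sum_const,
          Finset.card_image_of_injective _ (mul_left_injective g), nsmul_eq_mul, nsmul_eq_mul,
          ENNReal.add_div, mul_comm (K.card : ℝ≥0∞) η,
          ENNReal.mul_div_cancel_right hK0 (ENNReal.natCast_ne_top _), ENNReal.mul_div_right_comm]

end RDS

/-- A mean-L-stable RDS over a countable amenable group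
is Banach-mean equicontinuous. -/
theorem meanLStable_implies_bme
    {G : Type*} [Group G] [Countable G]
    {Ω : Type*} [MeasurableSpace Ω] [MulAction G Ω]
    {μ : Measure Ω} [IsProbabilityMeasure μ]
    {X : Type*} [MetricSpace X] [CompactSpace X] [MeasurableSpace X] [BorelSpace X]
    (hG : ∃ Φ : ℕ → Finset G, IsFolner Φ)
    (S : RDS G Ω μ X)
    (hMLS : S.MeanLStable) :
    S.BME := by
  intro ε hε
  set D := Metric.diam (univ : Set X)
  have hD : 0 ≤ D := Metric.diam_nonneg
  set η := ε / (2 * (1 + D)) with hηdef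
  have hη : 0 < η := by positivity
  have hηε : η + η * D < ε := by
    have : η + η * D = ε / 2 := by rw [hηdef]; field_simp
    linarith
  obtain ⟨δ, hδ, hstable⟩ := hMLS η hη
  refine ⟨δ, hδ, fun ω x y hx hy hxy => ?_⟩
  obtain ⟨K, hK, hKA⟩ :=
    exists_forall_card_filter_div_lt_of_upperBanachDensity_lt hG (hstable ω x y hx hy hxy)
  calc S.DB x y
      ≤ ⨆ g : G, (∑ t ∈ K.image fun k => k * g, S.dt t x y) / (K.card : ℝ≥0∞) :=
        iInf₂_le K hK
    _ ≤ ENNReal.ofReal η + ENNReal.ofReal η * ENNReal.ofReal D :=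
        iSup_le fun g => (S.sum_dt_div_card_le (S.dt_le_diam hx hy)
          (fun t ht => (not_le.mp ht).le) hK g).trans <| by
          gcongr
          exact (hKA g).le
    _ = ENNReal.ofReal (η + η * D) := by
        rw [ENNReal.ofReal_add hη.le (by positivity), ENNReal.ofReal_mul hη.le]
    _ < ENNReal.ofReal ε := (ENNReal.ofReal_lt_ofReal_iff hε).mpr hηε
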